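/- Let S be a set of seven distinct lines in Pic S₈ pairwise intersecting in 1 (an A₆⁸(1)-polytope). Then S has exactly seven Fano blocks, and for every pair of distinct lines in S there is exactly one Fano block containing both; that is, the seven lines together with the Fano blocks form a Steiner system S(2,3,7) (a Fano plane). -/

import Mathlib

/-!
Picard lattice of the degree 1 del Pezzo surface S₈:
Pic S₈ = ℤh ⊕ ℤe₁ ⊕ ⋯ ⊕ ℤe₈ ≅ ℤ⁹, with intersection pairing
h·h = 1, h·eᵢ = 0, eᵢ·eⱼ = −δᵢⱼ, and canonical class K = −3h + e₁ + ⋯ + e₈.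
-/

namespace DelPezzo

/-- The Picard lattice `Pic S₈ ≅ ℤ⁹`; coordinate `0` is the `h`-coordinate and
coordinates `1,…,8` are the `e₁,…,e₈`-coordinates. -/
abbrev Pic : Type := Fin 9 → ℤ

/-- The intersection pairing on `Pic S₈` (signature `(1,-8)`). -/
def inter (x y : Pic) : ℤ := x 0 * y 0 - ∑ i : Fin 8, x i.succ * y i.succ

/-- The canonical class `K = -3h + e₁ + ⋯ + e₈`. -/
def K : Pic := fun i => if i = 0 then -3 else 1

/-- A line: a class `l` with `l·l = -1` and `l·K = -1`. -/
def IsLine (l : Pic) : Prop := inter l l = -1 ∧ inter l K = -1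

/-- A finite set of lines is cornered if some line has intersection `0` with all of them. -/
def IsCornered (T : Finset Pic) : Prop := ∃ m : Pic, IsLine m ∧ ∀ x ∈ T, inter m x = 0

/-- A Fano block of an `A₆⁸(1)`-polytope `S`: a `3`-element subset of `S` not contained
in any `4`-element cornered subset of `S`. -/
def IsFanoBlock (S T : Finset Pic) : Prop :=
  T ⊆ S ∧ T.card = 3 ∧
    ¬ ∃ U : Finset Pic, U ⊆ S ∧ U.card = 4 ∧ T ⊆ U ∧ IsCornered U

/-! ### Four-element subsets of a seven-element set meeting in at most two points -/

section Combinatorics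

open Finset

variable {α : Type*} [DecidableEq α] {S : Finset α} {Q : Finset (Finset α)}

lemma card_uncovered_add_two_mul_card_filter_pair (hS : #S = 7) (hQ : ∀ U ∈ Q, U ⊆ S ∧ #U = 4)
    (hinter : ∀ U ∈ Q, ∀ V ∈ Q, U ≠ V → #(U ∩ V) ≤ 2) {x y : α} (hx : x ∈ S) (hy : y ∈ S)
    (hxy : x ≠ y) :
    #((S \ {x, y}) \ ({U ∈ Q | x ∈ U ∧ y ∈ U}.biUnion fun U => U \ {x, y})) +
        2 * #{U ∈ Q | x ∈ U ∧ y ∈ U} = 5 := by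
  have hpair : ∀ U : Finset α, x ∈ U → y ∈ U → #(U \ {x, y}) + 2 = #U := by
    intro U hxU hyU
    rw [← card_pair hxy]
    exact card_sdiff_add_card_eq_card (by grind)
  have hdisj : ∀ U ∈ {U ∈ Q | x ∈ U ∧ y ∈ U}, ∀ V ∈ {U ∈ Q | x ∈ U ∧ y ∈ U}, U ≠ V →
      Disjoint (U \ {x, y}) (V \ {x, y}) := by
    intro U hU V hV hUV
    simp only [mem_filter] at hU hV
    have h₁ := hpair (U ∩ V) (by grind) (by grind)
    have h₂ := hinter U hU.1 V hV.1 hUV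
    have h₃ : (U ∩ V) \ {x, y} = ∅ := card_eq_zero.mp (by omega)
    rw [disjoint_left]
    intro a haU haV
    have : a ∈ (U ∩ V) \ {x, y} := by grind
    simp [h₃] at this
  have hunion : #({U ∈ Q | x ∈ U ∧ y ∈ U}.biUnion fun U => U \ {x, y}) =
      2 * #{U ∈ Q | x ∈ U ∧ y ∈ U} := by
    rw [card_biUnion hdisj, sum_const_nat (m := 2), mul_comm]
    intro U hU
    simp only [mem_filter] at hU
    have := hpair U hU.2.1 hU.2.2
    have := (hQ U hU.1).2
    omega
  have hsub : ({U ∈ Q | x ∈ U ∧ y ∈ U}.biUnion fun U => U \ {x, y}) ⊆ S \ {x, y} :=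
    biUnion_subset.mpr fun U hU => sdiff_subset_sdiff (hQ U (mem_filter.mp hU).1).1 le_rfl
  have h₁ := card_sdiff_add_card_eq_card hsub
  have h₂ := hpair S hx hy
  omega

lemma sum_offDiag_card_filter_pair (hQ : ∀ U ∈ Q, U ⊆ S) {k : ℕ} (hk : ∀ U ∈ Q, #U = k) :
    ∑ p ∈ S.offDiag, #{U ∈ Q | p.1 ∈ U ∧ p.2 ∈ U} = #Q * (k * k - k) := by
  have := sum_card_bipartiteAbove_eq_sum_card_bipartiteBelow
    (s := S.offDiag) (t := Q) (fun p U => p.1 ∈ U ∧ p.2 ∈ U)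
  simp only [bipartiteAbove, bipartiteBelow] at this
  rw [this]
  refine sum_const_nat fun U hU => ?_
  rw [← hk U hU, ← offDiag_card]
  congr 1
  ext p
  have := hQ U hU
  simp only [mem_filter, mem_offDiag]
  grind

/-- Seven such subsets cover every pair exactly twice, hence miss exactly one triple
through each pair. -/
lemma existsUnique_third_point (hS : #S = 7) (hQ : ∀ U ∈ Q, U ⊆ S ∧ #U = 4)
    (hinter : ∀ U ∈ Q, ∀ V ∈ Q, U ≠ V → #(U ∩ V) ≤ 2) (hcard : 7 ≤ #Q)
    {x y : α} (hx : x ∈ S) (hy : y ∈ S) (hxy : x ≠ y) :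
    ∃! z, z ∈ S \ {x, y} ∧ ∀ U ∈ Q, ¬ {x, y, z} ⊆ U := by
  have hle : ∀ p ∈ S.offDiag, #{U ∈ Q | p.1 ∈ U ∧ p.2 ∈ U} ≤ 2 := by
    intro p hp
    rw [mem_offDiag] at hp
    have := card_uncovered_add_two_mul_card_filter_pair hS hQ hinter hp.1 hp.2.1 hp.2.2
    omega
  have hsum := sum_offDiag_card_filter_pair (fun U hU => (hQ U hU).1) fun U hU => (hQ U hU).2
  have htwo : ∑ p ∈ S.offDiag, #{U ∈ Q | p.1 ∈ U ∧ p.2 ∈ U} = ∑ p ∈ S.offDiag, 2 := by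
    refine le_antisymm (sum_le_sum hle) ?_
    rw [hsum, sum_const, offDiag_card, hS, smul_eq_mul]
    omega
  have heq := (sum_eq_sum_iff_of_le hle).mp htwo (x, y) (mem_offDiag.mpr ⟨hx, hy, hxy⟩)
  have hone := card_uncovered_add_two_mul_card_filter_pair hS hQ hinter hx hy hxy
  simp only at heq
  rw [heq] at hone
  obtain ⟨z, hz⟩ := card_eq_one.mp (show #((S \ {x, y}) \
    ({U ∈ Q | x ∈ U ∧ y ∈ U}.biUnion fun U => U \ {x, y})) = 1 by omega)
  have hmem : ∀ w, (w ∈ S \ {x, y} ∧ ∀ U ∈ Q, ¬ {x, y, w} ⊆ U) ↔ w = z := by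
    intro w
    rw [← mem_singleton, ← hz]
    refine Iff.trans (and_congr_right fun hw => ?_) mem_sdiff.symm
    simp only [mem_biUnion, mem_filter, mem_sdiff,
      (mem_sdiff.mp hw).2, not_false_eq_true, and_true, not_exists, not_and, and_imp,
      insert_subset_iff, singleton_subset_iff]
  exact ⟨z, (hmem z).mpr rfl, fun w hw => (hmem w).mp hw⟩

end Combinatorics

/-! ### The intersection form and sums of the roots `x + K` -/

section Lattice

open Finset

/-- The intersection pairing as a bilinear form. -/
def interForm : Pic →ₗ[ℤ] Pic →ₗ[ℤ] ℤ :=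
  LinearMap.mk₂ ℤ inter
    (fun x y z => by simp only [inter, Pi.add_apply, add_mul, sum_add_distrib]; ring)
    (fun c x y => by simp only [inter, Pi.smul_apply, smul_eq_mul, mul_assoc, ← mul_sum]; ring)
    (fun x y z => by simp only [inter, Pi.add_apply, mul_add, sum_add_distrib]; ring)
    (fun c x y => by
      simp only [inter, Pi.smul_apply, smul_eq_mul, mul_left_comm _ c, ← mul_sum]; ring)

lemma interForm_apply (x y : Pic) : interForm x y = inter x y := rfl

lemma inter_comm (x y : Pic) : inter x y = inter y x := by
  simp only [inter, mul_comm]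

lemma inter_K_K : inter K K = 1 := by decide

lemma two_dvd_inter_self_add_inter_K (x : Pic) : (2 : ℤ) ∣ inter x x + inter x K := by
  have h : inter x x + inter x K =
      (x 0 * (x 0 - 1) - 2 * x 0) - ∑ i : Fin 8, x i.succ * (x i.succ + 1) := by
    simp only [inter, K, mul_add, sum_add_distrib, Fin.succ_ne_zero, if_true, if_false, mul_one]
    ring
  rw [h]
  refine dvd_sub (dvd_sub ?_ (dvd_mul_right _ _)) (dvd_sum fun i _ => ?_)
  · exact (Int.even_mul_pred_self _).two_dvd
  · exact (Int.even_mul_succ_self _).two_dvd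

/-- The orthogonal complement of `K` is negative definite. -/
lemma eq_zero_of_inter_K_eq_zero {x : Pic} (hK : inter x K = 0) (hx : inter x x = 0) : x = 0 := by
  have hcs := sq_sum_le_card_mul_sum_sq (s := univ) (f := fun i : Fin 8 => x i.succ)
  have hsum : ∑ i : Fin 8, x i.succ = -3 * x 0 := by
    simp only [inter, K, Fin.succ_ne_zero, if_true, if_false, mul_one] at hK
    linarith
  have hsq : ∑ i : Fin 8, x i.succ ^ 2 = x 0 ^ 2 := by
    simp only [inter, ← sq] at hx
    linarith
  rw [hsum, hsq, card_univ, Fintype.card_fin] at hcs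
  have h0 : x 0 = 0 := by
    push_cast at hcs
    nlinarith [sq_nonneg (x 0)]
  rw [h0, zero_pow two_ne_zero, sum_eq_zero_iff_of_nonneg fun i _ => sq_nonneg _] at hsq
  ext i
  refine Fin.cases h0 (fun j => ?_) i
  exact pow_eq_zero_iff two_ne_zero |>.mp (hsq j (mem_univ j))

/-- The sum of the roots `x + K` over `T` is divisible by two in the Picard lattice. -/
def RootSumEven (T : Finset Pic) : Prop := ∃ m : Pic, ∑ x ∈ T, (x + K) = (2 : ℤ) • m

lemma RootSumEven.symmDiff {T U : Finset Pic} (hT : RootSumEven T) (hU : RootSumEven U) :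
    RootSumEven (T \ U ∪ U \ T) := by
  obtain ⟨m, hm⟩ := hT
  obtain ⟨n, hn⟩ := hU
  refine ⟨m + n - ∑ x ∈ T ∩ U, (x + K), ?_⟩
  rw [sum_union (disjoint_sdiff_sdiff), smul_sub, smul_add, ← hm, ← hn,
    ← sum_sdiff (inter_subset_left : T ∩ U ⊆ T), ← sum_sdiff (inter_subset_right : T ∩ U ⊆ U),
    sdiff_inter_self_left, sdiff_inter_self_right]
  module


lemma IsLine.inter_add_K_K {x : Pic} (hx : IsLine x) : inter (x + K) K = 0 := by
  rw [← interForm_apply, map_add, LinearMap.add_apply, interForm_apply, interForm_apply, hx.2,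
    inter_K_K]
  rfl

lemma inter_add_K_add_K {x y : Pic} (hx : IsLine x) (hy : IsLine y) :
    inter (x + K) (y + K) = inter x y - 1 := by
  simp only [← interForm_apply, map_add, LinearMap.add_apply]
  simp only [interForm_apply, inter_comm K y, hx.2, hy.2, inter_K_K]
  ring

section Polytope

variable {S : Finset Pic}

lemma inter_root_root (hline : ∀ x ∈ S, IsLine x)
    (hint : ∀ x ∈ S, ∀ y ∈ S, x ≠ y → inter x y = 1) {x y : Pic} (hx : x ∈ S) (hy : y ∈ S) :
    inter (x + K) (y + K) = if x = y then -2 else 0 := by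
  rw [inter_add_K_add_K (hline x hx) (hline y hy)]
  split_ifs with h
  · rw [← h, (hline x hx).1]; rfl
  · rw [hint x hx y hy h]; rfl

lemma inter_sum_root (hline : ∀ x ∈ S, IsLine x)
    (hint : ∀ x ∈ S, ∀ y ∈ S, x ≠ y → inter x y = 1) {x : Pic} (hx : x ∈ S) :
    inter (∑ y ∈ S, (y + K)) (x + K) = -2 := by
  rw [← interForm_apply, map_sum, LinearMap.sum_apply]
  simp only [interForm_apply]
  rw [sum_congr rfl fun y hy => inter_root_root hline hint hy hx, sum_ite_eq_of_mem' _ _ _ hx]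

lemma inter_sum_sum (hline : ∀ x ∈ S, IsLine x)
    (hint : ∀ x ∈ S, ∀ y ∈ S, x ≠ y → inter x y = 1) :
    inter (∑ x ∈ S, (x + K)) (∑ x ∈ S, (x + K)) = -2 * #S := by
  conv_lhs => rw [← interForm_apply, map_sum (interForm _)]
  simp only [interForm_apply]
  rw [sum_congr rfl fun x hx => inter_sum_root hline hint hx, sum_const, nsmul_eq_mul, mul_comm]

lemma inter_sum_K (hline : ∀ x ∈ S, IsLine x) : inter (∑ x ∈ S, (x + K)) K = 0 := by
  rw [← interForm_apply, map_sum, LinearMap.sum_apply]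
  exact sum_eq_zero fun x hx => (hline x hx).inter_add_K_K

lemma inter_two_smul_left (x y : Pic) : inter ((2 : ℤ) • x) y = 2 * inter x y := by
  simp only [← interForm_apply, map_smul, LinearMap.smul_apply, smul_eq_mul]

lemma half_sum_inter (hline : ∀ x ∈ S, IsLine x)
    (hint : ∀ x ∈ S, ∀ y ∈ S, x ≠ y → inter x y = 1) {m : Pic}
    (hm : ∑ x ∈ S, (x + K) = (2 : ℤ) • m) : 2 * inter m m = -#S ∧ inter m K = 0 := by
  have hsq := inter_sum_sum hline hint
  have hK := inter_sum_K hline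
  rw [hm, inter_two_smul_left] at hK
  rw [hm, inter_two_smul_left, inter_comm, inter_two_smul_left] at hsq
  constructor <;> linarith

lemma RootSumEven.four_dvd_card (hline : ∀ x ∈ S, IsLine x)
    (hint : ∀ x ∈ S, ∀ y ∈ S, x ≠ y → inter x y = 1) (hS : RootSumEven S) : 4 ∣ #S := by
  obtain ⟨m, hm⟩ := hS
  obtain ⟨hsq, hK⟩ := half_sum_inter hline hint hm
  have := two_dvd_inter_self_add_inter_K m
  omega

lemma RootSumEven.isCornered (hline : ∀ x ∈ S, IsLine x)
    (hint : ∀ x ∈ S, ∀ y ∈ S, x ≠ y → inter x y = 1) (hcard : #S = 4) (hS : RootSumEven S) :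
    IsCornered S := by
  obtain ⟨m, hm⟩ := hS
  obtain ⟨hsq, hK⟩ := half_sum_inter hline hint hm
  rw [hcard] at hsq
  have hKm : inter K m = 0 := by rw [inter_comm, hK]
  refine ⟨m - K, ⟨?_, ?_⟩, fun x hx => ?_⟩
  · simp only [← interForm_apply, map_sub, LinearMap.sub_apply]
    simp only [interForm_apply, hK, hKm, inter_K_K]
    push_cast at hsq
    linarith
  · simp only [← interForm_apply, map_sub, LinearMap.sub_apply]
    simp only [interForm_apply, hK, inter_K_K]
    rfl
  · have hroot := inter_sum_root hline hint hx
    rw [hm, inter_two_smul_left] at hroot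
    have hKx := (hline x hx).2
    rw [inter_comm] at hKx
    simp only [← interForm_apply, map_sub, map_add, LinearMap.sub_apply] at hroot ⊢
    simp only [interForm_apply, hK, hKx] at hroot ⊢
    linarith

lemma IsCornered.rootSumEven (hline : ∀ x ∈ S, IsLine x)
    (hint : ∀ x ∈ S, ∀ y ∈ S, x ≠ y → inter x y = 1) (hcard : #S = 4) (hS : IsCornered S) :
    RootSumEven S := by
  obtain ⟨n, hn, hnS⟩ := hS
  have hnsum : inter (n + K) (∑ x ∈ S, (x + K)) = -4 := by
    rw [← interForm_apply, map_sum]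
    simp only [interForm_apply]
    rw [sum_congr rfl fun x hx => by
      rw [inter_add_K_add_K hn (hline x hx), hnS x hx], sum_const, hcard]
    rfl
  have hsq := inter_sum_sum hline hint
  have hself := inter_add_K_add_K hn hn
  have hsumn := hnsum
  rw [inter_comm] at hsumn
  rw [hn.1] at hself
  rw [hcard] at hsq
  have hK := inter_sum_K hline
  have hnK := hn.inter_add_K_K
  refine ⟨n + K, (sub_eq_zero.mp (eq_zero_of_inter_K_eq_zero ?_ ?_)).symm⟩
  · simp only [← interForm_apply] at hK hnK ⊢
    simp only [map_sub, map_smul, LinearMap.sub_apply, LinearMap.smul_apply, hK, hnK]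
    rfl
  · simp only [← interForm_apply] at hnsum hsumn hsq hself ⊢
    simp only [map_sub, map_smul, LinearMap.sub_apply, LinearMap.smul_apply, hnsum, hsumn, hsq,
      hself]
    rfl

end Polytope

lemma rootSumEven_iff {T : Finset Pic} :
    RootSumEven T ↔ ∀ k, ((∑ x ∈ T, (x + K) k : ℤ) : ZMod 2) = 0 := by
  simp only [ZMod.intCast_zmod_eq_zero_iff_dvd]
  constructor
  · rintro ⟨m, hm⟩ k
    rw [← Finset.sum_apply, hm]
    exact ⟨m k, rfl⟩
  · intro h
    choose m hm using h
    refine ⟨m, funext fun k => ?_⟩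
    rw [Finset.sum_apply, hm]
    rfl

lemma intCast_inter_zmod_two (x y : Pic) :
    (inter x y : ZMod 2) = ∑ k, (x k : ZMod 2) * (y k : ZMod 2) := by
  rw [Fin.sum_univ_succ, inter]
  push_cast
  rw [sub_eq_add_neg, CharTwo.neg_eq]

/-- A self-orthogonal binary code in dimension nine has dimension at most four. -/
lemma eight_le_card_filter_rootSumEven {S : Finset Pic} [DecidablePred RootSumEven]
    (hcard : #S = 7) (heven : ∀ x ∈ S, ∀ y ∈ S, (2 : ℤ) ∣ inter (x + K) (y + K)) :
    8 ≤ #{T ∈ S.powerset | RootSumEven T} := by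
  classical
  let M : Matrix (Fin 9) S (ZMod 2) := Matrix.of fun k x => ((x.1 + K) k : ℤ)
  have hM : M.transpose * M = 0 := by
    ext x y
    rw [Matrix.mul_apply, Matrix.zero_apply]
    exact (intCast_inter_zmod_two _ _).symm.trans
      ((ZMod.intCast_zmod_eq_zero_iff_dvd _ 2).mpr (heven x x.2 y y.2))
  have hrank := Matrix.rank_add_rank_le_card_of_mul_eq_zero hM
  rw [Matrix.rank_transpose, Fintype.card_fin] at hrank
  have hker := LinearMap.finrank_range_add_finrank_ker M.mulVecLin
  rw [Module.finrank_fintype_fun_eq_card, Fintype.card_coe, hcard] at hker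
  rw [Matrix.rank] at hrank
  have h8 : 8 ≤ Fintype.card (LinearMap.ker M.mulVecLin) := by
    rw [Module.card_eq_pow_finrank (K := ZMod 2), ZMod.card]
    exact Nat.pow_le_pow_right (i := 3) two_pos (by omega)
  refine h8.trans (card_le_card_of_injOn
    (fun c => ({x | c.1 x ≠ 0} : Finset S).map (Function.Embedding.subtype _)) ?_ ?_)
  · intro c _
    simp only [coe_filter, mem_powerset, Set.mem_ofPred_eq]
    refine ⟨fun x hx => ?_, rootSumEven_iff.mpr fun k => ?_⟩
    · obtain ⟨y, -, rfl⟩ := mem_map.mp hx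
      exact y.2
    · have hc : ∑ x, M k x * c.1 x = 0 := congrFun (LinearMap.mem_ker.mp c.2) k
      rw [sum_map, Int.cast_sum, sum_filter]
      refine Eq.trans ?_ hc
      refine sum_congr rfl fun x _ => ?_
      have hbit : ∀ a : ZMod 2, a ≠ 0 → a = 1 := by decide
      split_ifs with hx
      · rw [hbit _ hx, mul_one]; rfl
      · rw [not_not.mp hx, mul_zero]
  · intro c _ d _ hcd
    have hsupp := map_injective _ hcd
    have hbit : ∀ a b : ZMod 2, (a ≠ 0 ↔ b ≠ 0) → a = b := by decide
    refine Subtype.ext (funext fun x => hbit _ _ ?_)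
    simpa using Finset.ext_iff.mp hsupp x

end Lattice

section FanoPlane

open Finset

variable {S : Finset Pic}

open Classical in
lemma existsUnique_fano_third_point (hcard : #S = 7) (hline : ∀ x ∈ S, IsLine x)
    (hint : ∀ x ∈ S, ∀ y ∈ S, x ≠ y → inter x y = 1) {x y : Pic} (hx : x ∈ S) (hy : y ∈ S)
    (hxy : x ≠ y) : ∃! z, z ∈ S \ {x, y} ∧ IsFanoBlock S {x, y, z} := by
  set Q : Finset (Finset Pic) := {T ∈ S.powerset | #T = 4 ∧ RootSumEven T} with hQ
  have hmemQ : ∀ {U}, U ∈ Q ↔ U ⊆ S ∧ #U = 4 ∧ RootSumEven U := by simp [hQ]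
  have hdvd : ∀ {T}, T ⊆ S → RootSumEven T → 4 ∣ #T := fun hT h =>
    h.four_dvd_card (fun x hx => hline x (hT hx)) fun x hx y hy => hint x (hT hx) y (hT hy)
  have hcornered : ∀ {T}, T ⊆ S → #T = 4 → (IsCornered T ↔ RootSumEven T) := fun hT h4 =>
    have hl := fun x hx => hline x (hT hx)
    have hi := fun x hx y hy => hint x (hT hx) y (hT hy)
    ⟨fun h => h.rootSumEven hl hi h4, fun h => h.isCornered hl hi h4⟩
  have hinterQ : ∀ U ∈ Q, ∀ V ∈ Q, U ≠ V → #(U ∩ V) ≤ 2 := by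
    intro U hU V hV hUV
    rw [hmemQ] at hU hV
    have hd := hdvd (union_subset (sdiff_subset.trans hU.1) (sdiff_subset.trans hV.1))
      (hU.2.2.symmDiff hV.2.2)
    rw [card_union_of_disjoint disjoint_sdiff_sdiff] at hd
    have h₁ := card_sdiff_add_card_inter U V
    have h₂ := card_sdiff_add_card_inter V U
    rw [Finset.inter_comm] at h₂
    have h₃ : #(U ∩ V) ≠ 4 := fun h => hUV <|
      (eq_of_subset_of_card_le inter_subset_left (by omega)).symm.trans
        (eq_of_subset_of_card_le inter_subset_right (by omega))
    omega
  have hQcard : 7 ≤ #Q := by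
    have h8 : 8 ≤ #{T ∈ S.powerset | RootSumEven T} :=
      eight_le_card_filter_rootSumEven hcard fun x hx y hy => by
        rw [inter_root_root hline hint hx hy]
        split_ifs <;> decide
    have hsub : {T ∈ S.powerset | RootSumEven T} ⊆ insert ∅ Q := by
      intro T hT
      rw [mem_filter, mem_powerset] at hT
      have hd := hdvd hT.1 hT.2
      have hle := card_le_card hT.1
      rw [mem_insert, hmemQ, ← card_eq_zero]
      by_cases h0 : #T = 0
      · exact Or.inl h0
      · exact Or.inr ⟨hT.1, by omega, hT.2⟩
    have h₁ := card_le_card hsub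
    have h₂ := card_insert_le ∅ Q
    omega
  have hmain := existsUnique_third_point hcard
    (fun U hU => ⟨(hmemQ.mp hU).1, (hmemQ.mp hU).2.1⟩) hinterQ hQcard hx hy hxy
  refine (existsUnique_congr fun z => and_congr_right fun hz => ?_).mp hmain
  rw [mem_sdiff, mem_insert, mem_singleton, not_or] at hz
  have hsub : {x, y, z} ⊆ S := by grind
  have hthree : #{x, y, z} = 3 := card_eq_three.mpr
    ⟨x, y, z, hxy, Ne.symm hz.2.1, Ne.symm hz.2.2, rfl⟩
  constructor
  · rintro h
    refine ⟨hsub, hthree, fun ⟨U, hU, h4, hT, hc⟩ => h U ?_ hT⟩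
    exact hmemQ.mpr ⟨hU, h4, (hcornered hU h4).mp hc⟩
  · rintro ⟨-, -, h⟩ U hU hT
    rw [hmemQ] at hU
    exact h ⟨U, hU.1, hU.2.1, hT, (hcornered hU.1 hU.2.1).mpr hU.2.2⟩

lemma existsUnique_isFanoBlock (hcard : #S = 7) (hline : ∀ x ∈ S, IsLine x)
    (hint : ∀ x ∈ S, ∀ y ∈ S, x ≠ y → inter x y = 1) {x y : Pic} (hx : x ∈ S) (hy : y ∈ S)
    (hxy : x ≠ y) : ∃! T : Finset Pic, IsFanoBlock S T ∧ x ∈ T ∧ y ∈ T := by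
  obtain ⟨z, ⟨-, hz⟩, huniq⟩ := existsUnique_fano_third_point hcard hline hint hx hy hxy
  refine ⟨{x, y, z}, ⟨hz, by simp, by simp⟩, fun T ⟨hT, hxT, hyT⟩ => ?_⟩
  have hpair : {x, y} ⊆ T := by grind
  have hone := card_sdiff_add_card_eq_card hpair
  rw [card_pair hxy, hT.2.1] at hone
  obtain ⟨w, hw⟩ := card_eq_one.mp (show #(T \ {x, y}) = 1 by omega)
  have hTw : T = {x, y, w} := by
    rw [← sdiff_union_of_subset hpair, hw]
    grind
  have hwT : w ∈ T \ {x, y} := by simp [hw]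
  rw [hTw, huniq w ⟨sdiff_subset_sdiff hT.1 le_rfl hwT, hTw ▸ hT⟩]

end FanoPlane

theorem fano_blocks_form_fano_plane (S : Finset Pic) (hcard : S.card = 7)
    (hline : ∀ x ∈ S, IsLine x)
    (hint : ∀ x ∈ S, ∀ y ∈ S, x ≠ y → inter x y = 1) :
    Set.ncard {T : Finset Pic | IsFanoBlock S T} = 7 ∧
    ∀ x ∈ S, ∀ y ∈ S, x ≠ y →
      ∃! T : Finset Pic, IsFanoBlock S T ∧ x ∈ T ∧ y ∈ T := by
  classical
  have huniq : ∀ x ∈ S, ∀ y ∈ S, x ≠ y → ∃! T : Finset Pic, IsFanoBlock S T ∧ x ∈ T ∧ y ∈ T :=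
    fun x hx y hy hxy => existsUnique_isFanoBlock hcard hline hint hx hy hxy
  refine ⟨?_, huniq⟩
  set B : Finset (Finset Pic) := {T ∈ S.powerset | IsFanoBlock S T} with hB
  have hmemB : ∀ {T}, T ∈ B ↔ IsFanoBlock S T := by
    intro T
    rw [hB, Finset.mem_filter, Finset.mem_powerset]
    exact and_iff_right_of_imp fun h => h.1
  have hset : {T : Finset Pic | IsFanoBlock S T} = B := Set.ext fun T => hmemB.symm
  rw [hset, Set.ncard_coe_finset]
  have hsum := sum_offDiag_card_filter_pair (S := S) (Q := B) (k := 3)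
    (fun T hT => (hmemB.mp hT).1) fun T hT => (hmemB.mp hT).2.1
  have hone : ∀ p ∈ S.offDiag, ({T ∈ B | p.1 ∈ T ∧ p.2 ∈ T} : Finset (Finset Pic)).card = 1 := by
    intro p hp
    rw [Finset.mem_offDiag] at hp
    obtain ⟨T, hT, hTu⟩ := huniq p.1 hp.1 p.2 hp.2.1 hp.2.2
    refine Finset.card_eq_one.mpr ⟨T, Finset.ext fun U => ?_⟩
    rw [Finset.mem_filter, hmemB, Finset.mem_singleton]
    exact ⟨hTu U, fun h => h ▸ hT⟩
  rw [Finset.sum_congr rfl hone, Finset.sum_const, Finset.offDiag_card, hcard, smul_eq_mul] at hsum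
  omega

end DelPezzo
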